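/- For every integer k ≥ 2, q(K_1 ∨ ((k−2)P_2 ∪ S_3 ∪ P_1)) > 2k + 1 + 2/(2k−1). -/

import Mathlib

namespace QPaper

open SimpleGraph

/-- The signless Laplacian matrix `Q(G) = D(G) + A(G)` of a graph, over `ℝ`. -/
noncomputable def signlessLap {V : Type*} [Fintype V] [DecidableEq V] (G : SimpleGraph V) :
    Matrix V V ℝ :=
  letI := Classical.decRel G.Adj
  G.degMatrix ℝ + G.adjMatrix ℝ

/-- The `Q`-index of a graph: the largest eigenvalue of its signless Laplacian matrix. -/
noncomputable def qIndex {V : Type*} [Fintype V] [DecidableEq V] (G : SimpleGraph V) : ℝ :=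
  sSup (spectrum ℝ (signlessLap G))

/-- The number of edges (size) of a graph. -/
noncomputable def numEdges {V : Type*} (G : SimpleGraph V) : ℕ :=
  Nat.card G.edgeSet

/-- The degree of a vertex. -/
noncomputable def deg {V : Type*} (G : SimpleGraph V) (v : V) : ℕ :=
  Nat.card (G.neighborSet v)

/-- A graph is `2` leaves-free if it has at most one vertex of degree one. -/
def TwoLeavesFree {V : Type*} (G : SimpleGraph V) : Prop :=
  ∀ u v : V, deg G u = 1 → deg G v = 1 → u = v

/-- The maximum degree `Δ(G)`. -/
noncomputable def maxDeg {V : Type*} [Fintype V] (G : SimpleGraph V) : ℕ :=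
  letI := Classical.decEq V
  letI := Classical.decRel G.Adj
  G.maxDegree

/-- `k` disjoint copies of `P₂`, i.e. a perfect matching on `2k` vertices. -/
def matching (k : ℕ) : SimpleGraph (Fin k × Fin 2) :=
  SimpleGraph.fromRel (fun a b => a.1 = b.1)

/-- The star graph `Sₙ` on `n` vertices (`K_{1,n-1}` with center `0`). -/
def starGraph (n : ℕ) : SimpleGraph (Fin n) :=
  SimpleGraph.fromRel (fun a _ => (a : ℕ) = 0)

/-- Disjoint union of two graphs. -/
def dUnion {α β : Type*} (G : SimpleGraph α) (H : SimpleGraph β) : SimpleGraph (α ⊕ β) :=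
  SimpleGraph.fromRel (fun a b =>
    (∃ x y, a = Sum.inl x ∧ b = Sum.inl y ∧ G.Adj x y) ∨
    (∃ x y, a = Sum.inr x ∧ b = Sum.inr y ∧ H.Adj x y))

/-- The join `K₁ ∨ H` : a new vertex (`none`) adjacent to every vertex of `H`. -/
def cone {α : Type*} (H : SimpleGraph α) : SimpleGraph (Option α) :=
  SimpleGraph.fromRel (fun a b =>
    a = none ∨ ∃ x y, a = some x ∧ b = some y ∧ H.Adj x y)

@[simp]
theorem cone_adj_none_some {α : Type*} (H : SimpleGraph α) (x : α) :
    (cone H).Adj none (some x) := by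
  simp [cone]

@[simp]
theorem cone_adj_some_none {α : Type*} (H : SimpleGraph α) (x : α) :
    (cone H).Adj (some x) none := by
  simp [cone]

@[simp]
theorem cone_adj_some_some {α : Type*} (H : SimpleGraph α) (x y : α) :
    (cone H).Adj (some x) (some y) ↔ H.Adj x y := by
  simpa [cone, H.adj_comm y x] using H.ne_of_adj

@[simp]
theorem dUnion_adj_inl_inl {α β : Type*} (G : SimpleGraph α) (H : SimpleGraph β) (x y : α) :
    (dUnion G H).Adj (Sum.inl x) (Sum.inl y) ↔ G.Adj x y := by
  simpa [dUnion, G.adj_comm y x] using G.ne_of_adj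

@[simp]
theorem dUnion_adj_inr_inr {α β : Type*} (G : SimpleGraph α) (H : SimpleGraph β) (x y : β) :
    (dUnion G H).Adj (Sum.inr x) (Sum.inr y) ↔ H.Adj x y := by
  simpa [dUnion, H.adj_comm y x] using H.ne_of_adj

@[simp]
theorem not_dUnion_adj_inl_inr {α β : Type*} (G : SimpleGraph α) (H : SimpleGraph β)
    (x : α) (y : β) : ¬ (dUnion G H).Adj (Sum.inl x) (Sum.inr y) := by
  simp [dUnion]

@[simp]
theorem not_dUnion_adj_inr_inl {α β : Type*} (G : SimpleGraph α) (H : SimpleGraph β)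
    (x : β) (y : α) : ¬ (dUnion G H).Adj (Sum.inr x) (Sum.inl y) := by
  simp [dUnion]

@[simp]
theorem matching_adj {n : ℕ} (i i' : Fin n) (j j' : Fin 2) :
    (matching n).Adj (i, j) (i', j') ↔ i = i' ∧ j ≠ j' := by
  simp only [matching, SimpleGraph.fromRel_adj, ne_eq, Prod.mk.injEq]
  grind

/-- The action of the signless Laplacian on a vector: the entry at `a` is the sum of `v a + v b`
over the neighbours `b` of `a`. -/
theorem signlessLap_mulVec_apply {V : Type*} [Fintype V] [DecidableEq V] (G : SimpleGraph V)
    [DecidableRel G.Adj] (v : V → ℝ) (a : V) :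
    (signlessLap G).mulVec v a = ∑ b, if G.Adj a b then v a + v b else 0 := by
  rw [signlessLap, Matrix.add_mulVec, Pi.add_apply, SimpleGraph.degMatrix_mulVec_apply,
    SimpleGraph.adjMatrix_mulVec_apply, ← Finset.sum_filter, Finset.sum_add_distrib,
    ← SimpleGraph.neighborFinset_eq_filter]
  simp only [Finset.sum_const, SimpleGraph.card_neighborFinset_eq_degree, nsmul_eq_mul]
  congr!

theorem isHermitian_signlessLap {V : Type*} [Fintype V] [DecidableEq V] (G : SimpleGraph V) :
    (signlessLap G).IsHermitian := by
  classical
  refine Matrix.IsHermitian.add ?_ ?_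
  · exact Matrix.isHermitian_diagonal _
  · rw [Matrix.IsHermitian, Matrix.conjTranspose_eq_transpose_of_trivial]
    exact SimpleGraph.transpose_adjMatrix _

/-- A Rayleigh quotient exceeding `t` forces an eigenvalue exceeding `t`. -/
theorem lt_sSup_spectrum_of_lt_dotProduct {V : Type*} [Fintype V] [DecidableEq V]
    {A : Matrix V V ℝ} (hA : A.IsHermitian) {t : ℝ} (v : V → ℝ)
    (h : t * (v ⬝ᵥ v) < v ⬝ᵥ A.mulVec v) : t < sSup (spectrum ℝ A) := by
  by_contra! hle
  have hpsd : (algebraMap ℝ (Matrix V V ℝ) t - A).PosSemidef := by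
    rw [Matrix.posSemidef_iff_isHermitian_and_spectrum_nonneg, ← spectrum.singleton_sub_eq]
    refine ⟨Matrix.IsHermitian.sub ?_ hA, ?_⟩
    · exact Matrix.isHermitian_diagonal _
    · rintro _ ⟨_, rfl, x, hx, rfl⟩
      exact sub_nonneg.2 ((le_csSup A.finite_real_spectrum.bddAbove hx).trans hle)
  have hnn := hpsd.dotProduct_mulVec_nonneg v
  rw [Algebra.algebraMap_eq_smul_one, Matrix.sub_mulVec, Matrix.smul_mulVec, Matrix.one_mulVec,
    star_trivial, dotProduct_sub, dotProduct_smul, smul_eq_mul] at hnn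
  linarith

/-- A nonnegative vector `v` with `t • v ≤ Q v`, strict at a vertex where `v` is positive,
certifies `t < q(G)`. -/
theorem lt_qIndex_of_le_mulVec {V : Type*} [Fintype V] [DecidableEq V] (G : SimpleGraph V)
    {t : ℝ} (v : V → ℝ) (hv : 0 ≤ v) (hle : ∀ a, t * v a ≤ (signlessLap G).mulVec v a)
    (a₀ : V) (ha₀ : 0 < v a₀) (hlt : t * v a₀ < (signlessLap G).mulVec v a₀) :
    t < qIndex G := by
  refine lt_sSup_spectrum_of_lt_dotProduct (isHermitian_signlessLap G) v ?_
  simp only [dotProduct, Finset.mul_sum]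
  refine Finset.sum_lt_sum (fun a _ => ?_) ⟨a₀, Finset.mem_univ _, ?_⟩
  · nlinarith [mul_le_mul_of_nonneg_left (hle a) (hv a)]
  · nlinarith [mul_lt_mul_of_pos_left hlt ha₀]

theorem center_inequality {m t : ℝ} (hm : 3 ≤ m) (ht : t = m + 2 + 2 / m) :
    t < m + 1 + (m - 3) / (t - 3) + (3 * t - 4) / ((t - 1) * (t - 4)) + 1 / (t - 1) := by
  have hm0 : 0 < m := by linarith
  have h1 : 0 < m ^ 2 + m + 2 := by positivity
  have h3 : 0 < m ^ 2 - m + 2 := by nlinarith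
  have h4 : 0 < m ^ 2 - 2 * m + 2 := by nlinarith
  have e1 : t - 1 = (m ^ 2 + m + 2) / m := by rw [ht]; field_simp; ring
  have e3 : t - 3 = (m ^ 2 - m + 2) / m := by rw [ht]; field_simp; ring
  have e4 : t - 4 = (m ^ 2 - 2 * m + 2) / m := by rw [ht]; field_simp; ring
  have e5 : 3 * t - 4 = (3 * m ^ 2 + 2 * m + 6) / m := by rw [ht]; field_simp; ring
  rw [e1, e3, e4, e5, ht, ← sub_pos]
  have key : m + 1 + (m - 3) / ((m ^ 2 - m + 2) / m) + (3 * m ^ 2 + 2 * m + 6) / m /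
      ((m ^ 2 + m + 2) / m * ((m ^ 2 - 2 * m + 2) / m)) + 1 / ((m ^ 2 + m + 2) / m) -
      (m + 2 + 2 / m) =
      (m ^ 2 * (m - 3) * (m ^ 2 + m + 2) * (m ^ 2 - 2 * m + 2) +
        4 * m ^ 2 * (m ^ 2 + 2) * (m ^ 2 - m + 2) -
        (m + 2) * (m ^ 2 - m + 2) * (m ^ 2 + m + 2) * (m ^ 2 - 2 * m + 2)) /
        (m * (m ^ 2 - m + 2) * (m ^ 2 + m + 2) * (m ^ 2 - 2 * m + 2)) := by
    generalize hA : m ^ 2 + m + 2 = A at h1 ⊢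
    generalize hB : m ^ 2 - m + 2 = B at h3 ⊢
    generalize hC : m ^ 2 - 2 * m + 2 = C at h4 ⊢
    field_simp
    subst hA hB hC
    ring
  rw [key]
  refine div_pos ?_ (by positivity)
  obtain ⟨s, hs, rfl⟩ : ∃ s, 0 ≤ s ∧ m = s + 3 := ⟨m - 3, by linarith, by ring⟩
  ring_nf
  positivity

/-- A vector on the vertices of `K₁ ∨ ((k-2)P₂ ∪ S₃ ∪ P₁)` that satisfies the eigenvalue equation
of the signless Laplacian for `t` at every vertex other than the apex. -/
noncomputable def testVector (n : ℕ) (t : ℝ) :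
    Option (Fin n × Fin 2 ⊕ Fin 3 ⊕ Fin 1) → ℝ
  | none => 1
  | some (Sum.inl _) => 1 / (t - 3)
  | some (Sum.inr (Sum.inl i)) => (if i = 0 then t else t - 2) / ((t - 1) * (t - 4))
  | some (Sum.inr (Sum.inr _)) => 1 / (t - 1)

theorem stmt14 (k : ℕ) (hk : 2 ≤ k) :
    qIndex (cone (dUnion (matching (k - 2)) (dUnion (starGraph 3) (pathGraph 1)))) > 2 * (k : ℝ) + 1 + 2 / (2 * (k : ℝ) - 1) := by
  classical
  obtain ⟨n, rfl⟩ := Nat.exists_eq_add_of_le' hk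
  rw [Nat.add_sub_cancel, gt_iff_lt]
  set t : ℝ := 2 * ((n + 2 : ℕ) : ℝ) + 1 + 2 / (2 * ((n + 2 : ℕ) : ℝ) - 1) with ht
  have hm : (3 : ℝ) ≤ 2 * n + 3 := by linarith [n.cast_nonneg (α := ℝ)]
  have htm : t = (2 * n + 3 : ℝ) + 2 + 2 / (2 * n + 3 : ℝ) := by
    rw [ht]; push_cast; ring_nf
  have hcenter := center_inequality hm htm
  have ht5 : 5 < t := by
    have : 0 < 2 / (2 * n + 3 : ℝ) := by positivity
    linarith
  clear_value t
  have h1 : 0 < t - 1 := by linarith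
  have h2 : 0 < t - 2 := by linarith
  have h3 : 0 < t - 3 := by linarith
  have h4 : 0 < t - 4 := by linarith
  have hnone : t * testVector n t none < (signlessLap (cone (dUnion (matching n)
      (dUnion (starGraph 3) (pathGraph 1))))).mulVec (testVector n t) none := by
    rw [signlessLap_mulVec_apply]
    simp [Fintype.sum_option, Fin.sum_univ_succ, testVector]
    refine hcenter.trans_eq ?_
    field_simp
    ring
  refine lt_qIndex_of_le_mulVec _ (testVector n t) ?_ ?_ none one_pos hnone
  · rintro (_ | _ | i | _) <;> simp only [testVector, Pi.zero_apply] <;> (try split_ifs) <;>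
      positivity
  · rintro (_ | ⟨i, j⟩ | i | i)
    · exact hnone.le
    · rw [signlessLap_mulVec_apply]
      fin_cases j <;>
        simp [Fintype.sum_option, Fin.sum_univ_succ, testVector, Fintype.sum_prod_type] <;>
        field_simp <;> linarith
    · rw [signlessLap_mulVec_apply]
      fin_cases i <;>
        simp [Fintype.sum_option, Fin.sum_univ_succ, testVector, starGraph] <;>
        field_simp <;> nlinarith
    · rw [signlessLap_mulVec_apply]
      simp [Fintype.sum_option, testVector, Subsingleton.elim i 0]
      field_simp
      linarith

end QPaper
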